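/- Let m ≥ 1 and let R_1, ..., R_m be real numbers that are not all equal. Then R_MM(λ_min) tends to +∞ as λ_min tends to −∞, where R_MM(λ_min) is the Minimax-REx objective. (Proposition 1: MM-REx enforces the REx principle in the limit.) -/

import Mathlib

/-- The values of the Minimax-REx linear programme are bounded above. -/
theorem bddAbove_minimax_rex_values {ι : Type*} [Fintype ι] (R : ι → ℝ) (lamMin : ℝ) :
    BddAbove {x : ℝ | ∃ lam : ι → ℝ,
      (∑ e, lam e) = 1 ∧ (∀ e, lamMin ≤ lam e) ∧ x = ∑ e, lam e * R e} := by
  refine ⟨∑ e, lamMin * R e + (1 - ∑ _e : ι, lamMin) * ∑ e, |R e|, ?_⟩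
  rintro x ⟨lam, hsum, hle, rfl⟩
  rw [← hsum, ← Finset.sum_sub_distrib, Finset.sum_mul, ← Finset.sum_add_distrib]
  refine Finset.sum_le_sum fun e _ => ?_
  have hR : R e ≤ ∑ i, |R i| :=
    (le_abs_self _).trans
      (Finset.single_le_sum (f := fun i => |R i|) (fun i _ => abs_nonneg _) (Finset.mem_univ e))
  linarith [mul_le_mul_of_nonneg_left hR (sub_nonneg.2 (hle e))]

/-- Shifting as much weight as possible from one environment to another gives a lower bound
on the Minimax-REx objective. -/
theorem le_sSup_minimax_rex_values {ι : Type*} [Fintype ι] (R : ι → ℝ) (d e : ι)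
    {lamMin : ℝ} (h : lamMin ≤ 0) :
    lamMin * (R d - R e) + R e ≤ sSup {x : ℝ | ∃ lam : ι → ℝ,
      (∑ e, lam e) = 1 ∧ (∀ e, lamMin ≤ lam e) ∧ x = ∑ e, lam e * R e} := by
  classical
  refine le_csSup (bddAbove_minimax_rex_values R lamMin)
    ⟨Pi.single d lamMin + Pi.single e (1 - lamMin), ?_, fun i => ?_, ?_⟩
  · simp [Finset.sum_add_distrib]
  · simp only [Pi.add_apply, Pi.single_apply]
    split_ifs <;> linarith
  · simp only [Pi.add_apply, add_mul, Finset.sum_add_distrib, Pi.single_apply, ite_mul, zero_mul,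
      Finset.sum_ite_eq', Finset.mem_univ, if_true]
    ring

/-- Proposition 1 (MM-REx enforces the REx principle in the limit): if the `m ≥ 1`
risks `R 1, ..., R m` are not all equal, then the Minimax-REx objective
`R_MM(λ_min) = sup { ∑ e, λ e * R e : ∑ e, λ e = 1, λ e ≥ λ_min ∀ e }`
tends to `+∞` as `λ_min → −∞`. -/
theorem minimax_rex_tendsto_atTop (m : ℕ) (hm : 0 < m) (R : Fin m → ℝ)
    (hne : ¬ ∀ d e, R d = R e) :
    Filter.Tendsto
      (fun lamMin : ℝ =>
        sSup {x : ℝ | ∃ lam : Fin m → ℝ,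
          (∑ e, lam e) = 1 ∧ (∀ e, lamMin ≤ lam e) ∧ x = ∑ e, lam e * R e})
      Filter.atBot Filter.atTop := by
  obtain ⟨d, e, hde⟩ : ∃ d e, R d < R e := by
    by_contra! h
    exact hne fun d e => le_antisymm (h e d) (h d e)
  refine Filter.tendsto_atTop_mono' _ ?_ (Filter.tendsto_atTop_add_const_right _ (R e)
    (Filter.tendsto_id.atBot_mul_const_of_neg (sub_neg.2 hde)))
  filter_upwards [Filter.eventually_le_atBot 0] with lamMin h
  exact le_sSup_minimax_rex_values R d e h
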